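/- Let m ≥ 2 be an integer. For every positive integer n and every m-homogeneous polynomial P(x) = ∑_{|α|=m} a_α x^α on complex ℓ_m^n, one has max_{|α|=m} |a_α| ≤ (2/√π)^{m−1} m^m ‖P‖. -/

import Mathlib

open scoped BigOperators

/-- The `ℓ_p` norm of a vector in `ℂ^n`: `(∑ i, ‖x i‖^p)^(1/p)`. -/
noncomputable def lpNorm (p : ℝ) {n : ℕ} (x : Fin n → ℂ) : ℝ :=
  (∑ i, ‖x i‖ ^ p) ^ (1 / p)

/-- The sup norm of a complex polynomial on the unit ball of `ℓ_p^n`. -/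
noncomputable def polyNorm (p : ℝ) {n : ℕ} (P : MvPolynomial (Fin n) ℂ) : ℝ :=
  sSup {t : ℝ | ∃ x : Fin n → ℂ, lpNorm p x ≤ 1 ∧ t = ‖MvPolynomial.eval x P‖}

theorem norm_le_one_of_lpNorm_le_one {p : ℝ} (hp : 0 < p) {n : ℕ} {x : Fin n → ℂ}
    (hx : lpNorm p x ≤ 1) (i : Fin n) : ‖x i‖ ≤ 1 := by
  have hsum : 0 ≤ ∑ i, ‖x i‖ ^ p := Finset.sum_nonneg fun i _ => by positivity
  have hle : ∑ i, ‖x i‖ ^ p ≤ 1 := by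
    by_contra! h
    exact absurd hx (not_le.2 (Real.one_lt_rpow h (by positivity)))
  have hi : ‖x i‖ ^ p ≤ 1 :=
    (Finset.single_le_sum (f := fun i => ‖x i‖ ^ p) (fun i _ => by positivity)
      (Finset.mem_univ i)).trans hle
  by_contra! h
  exact absurd hi (not_le.2 (Real.one_lt_rpow h hp))

theorem norm_eval_le_polyNorm {p : ℝ} (hp : 0 < p) {n : ℕ} (P : MvPolynomial (Fin n) ℂ)
    {x : Fin n → ℂ} (hx : lpNorm p x ≤ 1) : ‖MvPolynomial.eval x P‖ ≤ polyNorm p P := by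
  refine le_csSup ⟨∑ β ∈ P.support, ‖P.coeff β‖, ?_⟩ ⟨x, hx, rfl⟩
  rintro _ ⟨y, hy, rfl⟩
  rw [MvPolynomial.eval_eq']
  refine norm_sum_le_of_le _ fun β _ => ?_
  rw [norm_mul, norm_prod]
  refine mul_le_of_le_one_right (norm_nonneg _)
    (Finset.prod_le_one (fun i _ => norm_nonneg _) fun i _ => ?_)
  rw [norm_pow]
  exact pow_le_one₀ (norm_nonneg _) (norm_le_one_of_lpNorm_le_one hp hy i)

/-- Geometric sums of ratios of powers of a primitive root of unity vanish. -/
theorem IsPrimitiveRoot.sum_pow_div_pow_eq_zero {N : ℕ} {ω : ℂ} (hω : IsPrimitiveRoot ω N)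
    {a b : ℕ} (ha : a < N) (hb : b < N) (hab : a ≠ b) :
    ∑ j : Fin N, (ω ^ a / ω ^ b) ^ (j : ℕ) = 0 := by
  have hω0 : ω ≠ 0 := hω.ne_zero (by omega)
  have hne : ω ^ a / ω ^ b ≠ 1 := fun h =>
    hab (hω.pow_inj ha hb ((div_eq_one_iff_eq (pow_ne_zero _ hω0)).1 h))
  rw [Fin.sum_univ_eq_sum_range (fun j => (ω ^ a / ω ^ b) ^ j) N, geom_sum_eq hne, div_pow,
    ← pow_mul, ← pow_mul, mul_comm a, mul_comm b, pow_mul, pow_mul, hω.pow_eq_one]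
  simp

/-- Cauchy's estimate on a polytorus, from averaging over roots of unity. -/
theorem norm_coeff_mul_prod_le {n N : ℕ} (hN : 0 < N) (P : MvPolynomial (Fin n) ℂ)
    (hdeg : ∀ β ∈ P.support, ∀ i, β i < N) (α : Fin n →₀ ℕ) (hα : ∀ i, α i < N)
    (r : Fin n → ℝ) (hr : ∀ i, 0 ≤ r i) (C : ℝ)
    (hC : ∀ x : Fin n → ℂ, (∀ i, ‖x i‖ = r i) → ‖MvPolynomial.eval x P‖ ≤ C) :
    ‖P.coeff α‖ * ∏ i, r i ^ α i ≤ C := by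
  obtain ⟨ω, hω⟩ : ∃ ω : ℂ, IsPrimitiveRoot ω N :=
    ⟨_, Complex.isPrimitiveRoot_exp N hN.ne'⟩
  have hω0 : ω ≠ 0 := hω.ne_zero hN.ne'
  have hω1 : ‖ω‖ = 1 := hω.norm'_eq_one hN.ne'
  have key : ∑ k : Fin n → Fin N,
      MvPolynomial.eval (fun i => (r i : ℂ) * ω ^ (k i : ℕ)) P * ∏ i, ((ω ^ α i)⁻¹) ^ (k i : ℕ)
      = (N : ℂ) ^ n * (P.coeff α * ∏ i, (r i : ℂ) ^ α i) := by
    have expand (k : Fin n → Fin N) :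
        MvPolynomial.eval (fun i => (r i : ℂ) * ω ^ (k i : ℕ)) P * ∏ i, ((ω ^ α i)⁻¹) ^ (k i : ℕ)
        = ∑ β ∈ P.support, P.coeff β * (∏ i, (r i : ℂ) ^ β i) *
            ∏ i, (ω ^ β i / ω ^ α i) ^ (k i : ℕ) := by
      rw [MvPolynomial.eval_eq', Finset.sum_mul]
      refine Finset.sum_congr rfl fun β _ => ?_
      rw [mul_assoc, mul_assoc, ← Finset.prod_mul_distrib, ← Finset.prod_mul_distrib]
      congr 1
      refine Finset.prod_congr rfl fun i _ => ?_
      rw [mul_pow, div_eq_mul_inv, mul_pow, ← pow_mul, ← pow_mul, mul_comm (k i : ℕ), mul_assoc]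
    have orth (β : Fin n →₀ ℕ) :
        ∑ k : Fin n → Fin N, ∏ i, (ω ^ β i / ω ^ α i) ^ (k i : ℕ)
        = ∏ i, ∑ j : Fin N, (ω ^ β i / ω ^ α i) ^ (j : ℕ) := by
      rw [Finset.prod_univ_sum, Fintype.piFinset_univ]
    simp_rw [expand]
    rw [Finset.sum_comm]
    simp_rw [← Finset.mul_sum, orth]
    rw [Finset.sum_eq_single α]
    · simp [hω0, mul_comm]
    · intro β hβ hne
      obtain ⟨i, hi⟩ := DFunLike.ne_iff.1 hne
      exact mul_eq_zero_of_right _ (Finset.prod_eq_zero (Finset.mem_univ i)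
        (hω.sum_pow_div_pow_eq_zero (hdeg β hβ i) (hα i) hi))
    · intro h
      rw [MvPolynomial.notMem_support_iff.1 h, zero_mul, zero_mul]
  have hle := norm_sum_le_of_le (Finset.univ : Finset (Fin n → Fin N))
    (f := fun k => MvPolynomial.eval (fun i => (r i : ℂ) * ω ^ (k i : ℕ)) P *
      ∏ i, ((ω ^ α i)⁻¹) ^ (k i : ℕ)) (n := fun _ => C) fun k _ => by
    simp only [norm_mul, norm_prod, norm_pow, norm_inv, hω1, one_pow, inv_one,
      Finset.prod_const_one, mul_one]
    exact hC _ fun i => by simp [hω1, abs_of_nonneg (hr i)]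
  rw [key] at hle
  simp only [norm_mul, norm_prod, norm_pow, Complex.norm_natCast, Complex.norm_real,
    Real.norm_eq_abs, abs_of_nonneg (hr _), Finset.sum_const, Finset.card_univ, Fintype.card_fun,
    Fintype.card_fin, nsmul_eq_mul, Nat.cast_pow] at hle
  exact le_of_mul_le_mul_left hle (by positivity)

theorem complex_HL_m_homogeneous_on_ell_m
    (m : ℕ) (hm : 2 ≤ m) (n : ℕ) (hn : 0 < n)
    (P : MvPolynomial (Fin n) ℂ) (hP : P.IsHomogeneous m)
    (α : Fin n →₀ ℕ) (hα : (∑ i ∈ α.support, α i) = m) :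
    ‖MvPolynomial.coeff α P‖ ≤ (2 / Real.sqrt Real.pi) ^ (m - 1) * (m : ℝ) ^ m * polyNorm (m : ℝ) P := by
  have hm0 : (0 : ℝ) < m := by positivity
  have hm1 : (1 : ℝ) ≤ m := by exact_mod_cast (by omega : 1 ≤ m)
  have le_degree (β : Fin n →₀ ℕ) (hβ : ∑ i ∈ β.support, β i = m) (i : Fin n) : β i < m + 1 := by
    have := β.le_degree i
    rw [Finsupp.degree_apply, hβ] at this
    omega
  have hcard : α.support.card ≤ m := by
    rw [← hα, Finset.card_eq_sum_ones]
    exact Finset.sum_le_sum fun i hi => Nat.one_le_iff_ne_zero.2 (Finsupp.mem_support_iff.1 hi)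
  let r : Fin n → ℝ := fun i => if i ∈ α.support then (m : ℝ)⁻¹ else 0
  have hr (i : Fin n) : 0 ≤ r i := by
    dsimp only [r]; split_ifs <;> positivity
  have hsum : ∑ i, r i ^ (m : ℝ) ≤ 1 := by
    have hterm (i : Fin n) : r i ^ (m : ℝ) ≤ r i := by
      rw [Real.rpow_natCast]
      refine pow_le_of_le_one (hr i) ?_ (by omega)
      dsimp only [r]; split_ifs
      · exact inv_le_one_of_one_le₀ hm1
      · exact zero_le_one
    calc ∑ i, r i ^ (m : ℝ) ≤ ∑ i, r i := Finset.sum_le_sum fun i _ => hterm i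
      _ = α.support.card * (m : ℝ)⁻¹ := by
        simp only [r, Finset.sum_ite_mem, Finset.univ_inter, Finset.sum_const, nsmul_eq_mul]
      _ ≤ m * (m : ℝ)⁻¹ := by gcongr
      _ = 1 := mul_inv_cancel₀ hm0.ne'
  have hprod : ∏ i, r i ^ α i = ((m : ℝ) ^ m)⁻¹ := by
    have hterm (i : Fin n) : r i ^ α i = (m : ℝ)⁻¹ ^ α i := by
      by_cases h : i ∈ α.support
      · simp only [r, if_pos h]
      · simp [Finsupp.notMem_support_iff.1 h]
    have hdeg : ∑ i, α i = m := by
      rw [← hα]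
      exact (Finset.sum_subset (Finset.subset_univ _) fun i _ h =>
        Finsupp.notMem_support_iff.1 h).symm
    rw [Finset.prod_congr rfl fun i _ => hterm i, Finset.prod_pow_eq_pow_sum, hdeg, inv_pow]
  have hcauchy := norm_coeff_mul_prod_le m.succ_pos P
    (fun β hβ => le_degree β (by
      rw [← Finsupp.degree_apply, Finsupp.degree_eq_weight_one]
      exact hP (MvPolynomial.mem_support_iff.1 hβ)))
    α (le_degree α hα) r hr (polyNorm m P) fun x hx => norm_eval_le_polyNorm hm0 P (by
      simp only [lpNorm, hx]
      exact Real.rpow_le_one (Finset.sum_nonneg fun i _ => Real.rpow_nonneg (hr i) _) hsum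
        (by positivity))
  rw [hprod, ← div_eq_mul_inv, div_le_iff₀ (by positivity), mul_comm] at hcauchy
  have hpoly : 0 ≤ (m : ℝ) ^ m * polyNorm m P := (norm_nonneg _).trans hcauchy
  have hconst : 1 ≤ 2 / Real.sqrt Real.pi := by
    rw [one_le_div (by positivity), Real.sqrt_le_left zero_le_two]
    linarith [Real.pi_le_four]
  rw [mul_assoc]
  exact hcauchy.trans (le_mul_of_one_le_left hpoly (one_le_pow₀ hconst))
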